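/- arXiv:1707.05232 — 2 statements merged into one kernel-verified Lean document; each statement's English description precedes it below -/
import Mathlib

section
/- For any response y ∈ ℝⁿ, any design X ∈ ℝ^{n×p}, and any λ₁ > 0, there exists λ₀ > 0 such that for every λ₂ ≥ λ₀, the Sign-Least-Squares Lasso β̃ (least squares on the equicorrelation set E of β̂^{λ₁} under the sign constraints ρ̂^{λ₁}_E ⊙ β_E ≥ 0, with zero coordinates off E) is a solution of the Bregman Lasso problem with parameters (λ₁, λ₂): β̂^{λ₁,λ₂} = β̃. -/
open MeasureTheory ProbabilityTheory Finset

noncomputable section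

/-- Product Gaussian measure `N(0, σ² I_n)` on `ℝⁿ`. -/
def gaussianVec (n : ℕ) (σ : ℝ) : Measure (Fin n → ℝ) :=
  Measure.pi fun _ => gaussianReal 0 (σ ^ 2).toNNReal

/-- Squared Euclidean norm. -/
def l2sq {m : ℕ} (v : Fin m → ℝ) : ℝ := ∑ i, (v i) ^ 2

/-- Euclidean norm. -/
def l2 {m : ℕ} (v : Fin m → ℝ) : ℝ := Real.sqrt (l2sq v)

/-- ℓ₁ norm. -/
def l1 {m : ℕ} (v : Fin m → ℝ) : ℝ := ∑ i, |v i|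

/-- Lasso objective `(1/2n)‖y − Xβ‖₂² + λ‖β‖₁`. -/
def lassoObj {n p : ℕ} (X : Matrix (Fin n) (Fin p) ℝ) (y : Fin n → ℝ) (lam : ℝ)
    (β : Fin p → ℝ) : ℝ :=
  l2sq (y - X.mulVec β) / (2 * (n : ℝ)) + lam * l1 β

/-- `b` is a Lasso solution with tuning parameter `lam`. -/
def IsLassoSol {n p : ℕ} (X : Matrix (Fin n) (Fin p) ℝ) (y : Fin n → ℝ) (lam : ℝ)
    (b : Fin p → ℝ) : Prop :=
  ∀ β : Fin p → ℝ, lassoObj X y lam b ≤ lassoObj X y lam β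

/-- Restricted eigenvalue condition RE(c₀, s) with constant `κ`:
for every `J` with `|J| ≤ s` and every `Δ` with `‖Δ_{Jᶜ}‖₁ ≤ c₀‖Δ_J‖₁`,
one has `‖XΔ‖₂² ≥ κ² n ‖Δ_J‖₂²`. -/
def RE {n p : ℕ} (X : Matrix (Fin n) (Fin p) ℝ) (c0 : ℝ) (s : ℕ) (κ : ℝ) : Prop :=
  0 < κ ∧ ∀ J : Finset (Fin p), J.card ≤ s → ∀ Δ : Fin p → ℝ,
    (∑ j ∈ Jᶜ, |Δ j|) ≤ c0 * ∑ j ∈ J, |Δ j| →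
    κ ^ 2 * ((n : ℝ) * ∑ j ∈ J, (Δ j) ^ 2) ≤ l2sq (X.mulVec Δ)

/-- The Lasso subgradient `ρ̂ = Xᵀ(y − Xβ̂)/(λ n)`. -/
def lassoSubgrad {n p : ℕ} (X : Matrix (Fin n) (Fin p) ℝ) (y : Fin n → ℝ) (lam : ℝ)
    (b : Fin p → ℝ) : Fin p → ℝ :=
  fun j => (X.transpose.mulVec (y - X.mulVec b)) j / (lam * (n : ℝ))

/-- Boosted Lasso objective `(1/2n)‖y − Xβ‖₂² + λ₂‖β − β̂‖₁`. -/
def boostedObj {n p : ℕ} (X : Matrix (Fin n) (Fin p) ℝ) (y : Fin n → ℝ) (lam2 : ℝ)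
    (bhat β : Fin p → ℝ) : ℝ :=
  l2sq (y - X.mulVec β) / (2 * (n : ℝ)) + lam2 * l1 (β - bhat)

/-- `b` is a Boosted Lasso solution built upon the first-step estimator `bhat`. -/
def IsBoostedSol {n p : ℕ} (X : Matrix (Fin n) (Fin p) ℝ) (y : Fin n → ℝ) (lam2 : ℝ)
    (bhat b : Fin p → ℝ) : Prop :=
  ∀ β : Fin p → ℝ, boostedObj X y lam2 bhat b ≤ boostedObj X y lam2 bhat β

/-- Bregman Lasso objective
`(1/2n)‖y − Xβ‖₂² + λ₂(‖β‖₁ − ⟨ρ̂^{λ₁}, β⟩)` where `ρ̂^{λ₁}` is the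
Lasso subgradient associated with `bhat`. -/
def bregmanObj {n p : ℕ} (X : Matrix (Fin n) (Fin p) ℝ) (y : Fin n → ℝ) (lam1 lam2 : ℝ)
    (bhat β : Fin p → ℝ) : ℝ :=
  l2sq (y - X.mulVec β) / (2 * (n : ℝ)) +
    lam2 * (l1 β - ∑ j, lassoSubgrad X y lam1 bhat j * β j)

/-- `b` is a Bregman Lasso solution with parameters `(lam1, lam2)`. -/
def IsBregmanSol {n p : ℕ} (X : Matrix (Fin n) (Fin p) ℝ) (y : Fin n → ℝ) (lam1 lam2 : ℝ)
    (bhat b : Fin p → ℝ) : Prop :=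
  ∀ β : Fin p → ℝ, bregmanObj X y lam1 lam2 bhat b ≤ bregmanObj X y lam1 lam2 bhat β

/-- `bbar` is a sign-consistent refitting of the Lasso solution `bhat`:
it does not increase the residual norm and `(1/n)Xᵀ(y − Xβ̂) ∈ λ·sign(β̄)`
componentwise. -/
def SignConsistentRefit {n p : ℕ} (X : Matrix (Fin n) (Fin p) ℝ) (y : Fin n → ℝ) (lam : ℝ)
    (bhat bbar : Fin p → ℝ) : Prop :=
  l2 (y - X.mulVec bbar) ≤ l2 (y - X.mulVec bhat) ∧
  ∀ j, (0 < bbar j → X.transpose.mulVec (y - X.mulVec bhat) j / (n : ℝ) = lam) ∧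
       (bbar j < 0 → X.transpose.mulVec (y - X.mulVec bhat) j / (n : ℝ) = -lam) ∧
       (bbar j = 0 → |X.transpose.mulVec (y - X.mulVec bhat) j / (n : ℝ)| ≤ lam)

/-- `bbar` is a Sign-Least-Squares Lasso refitting of the Lasso solution `bhat`:
it vanishes outside the equicorrelation set `E = {j : |ρ̂_j| = 1}` and minimizes
the residual sum of squares among all vectors supported on `E` whose coordinates
have signs compatible with `ρ̂_E`. -/
def IsSLSSol {n p : ℕ} (X : Matrix (Fin n) (Fin p) ℝ) (y : Fin n → ℝ) (lam : ℝ)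
    (bhat bbar : Fin p → ℝ) : Prop :=
  (∀ j, |lassoSubgrad X y lam bhat j| ≠ 1 → bbar j = 0) ∧
  (∀ j, 0 ≤ lassoSubgrad X y lam bhat j * bbar j) ∧
  ∀ β : Fin p → ℝ,
    ((∀ j, |lassoSubgrad X y lam bhat j| ≠ 1 → β j = 0) ∧
     (∀ j, 0 ≤ lassoSubgrad X y lam bhat j * β j)) →
    l2sq (y - X.mulVec bbar) ≤ l2sq (y - X.mulVec β)

/-- Componentwise soft-thresholding operator `softThresh(y, λ)_j = sign(y_j)(|y_j| − λ)₊`. -/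
def softThresh {p : ℕ} (y : Fin p → ℝ) (lam : ℝ) : Fin p → ℝ :=
  fun j => Real.sign (y j) * max (|y j| - lam) 0

/-- Componentwise firm-thresholding (MCP) operator. -/
def MCP {p : ℕ} (y : Fin p → ℝ) (μ γ : ℝ) : Fin p → ℝ :=
  fun j => if |y j| ≤ μ * γ then γ / (γ - 1) * (Real.sign (y j) * max (|y j| - μ) 0) else y j

/-- Bregman objective in the denoising (orthogonal, `X = I_p`) case:
`(1/2)‖y − β‖₂² + λ(‖β‖₁ − ⟨ρ, β⟩)`. -/
def denoiseBregObj {p : ℕ} (y ρ : Fin p → ℝ) (lam : ℝ) (β : Fin p → ℝ) : ℝ :=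
  (1 / 2) * l2sq (y - β) + lam * (l1 β - ∑ j, ρ j * β j)

end

lemma l2sq_nonneg {m : ℕ} (v : Fin m → ℝ) : 0 ≤ l2sq v :=
  Finset.sum_nonneg fun _ _ => sq_nonneg _

lemma l2sq_smul {m : ℕ} (t : ℝ) (v : Fin m → ℝ) : l2sq (t • v) = t ^ 2 * l2sq v := by
  simp [l2sq, mul_pow, Finset.mul_sum]

/-- Second-order expansion of the residual sum of squares. -/
lemma l2sq_sub_mulVec_add {n p : ℕ} (X : Matrix (Fin n) (Fin p) ℝ) (y : Fin n → ℝ)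
    (b d : Fin p → ℝ) :
    l2sq (y - X.mulVec (b + d)) = l2sq (y - X.mulVec b)
      - 2 * ∑ j, X.transpose.mulVec (y - X.mulVec b) j * d j + l2sq (X.mulVec d) := by
  have hadj : ∑ j, X.transpose.mulVec (y - X.mulVec b) j * d j
      = ∑ i, (y - X.mulVec b) i * X.mulVec d i := by
    change X.transpose.mulVec (y - X.mulVec b) ⬝ᵥ d = (y - X.mulVec b) ⬝ᵥ X.mulVec d
    rw [Matrix.mulVec_transpose, Matrix.dotProduct_mulVec]
  rw [hadj, Matrix.mulVec_add]
  simp only [l2sq, Finset.mul_sum, ← Finset.sum_sub_distrib, ← Finset.sum_add_distrib]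
  refine Finset.sum_congr rfl fun i _ => ?_
  simp only [Pi.sub_apply, Pi.add_apply]
  ring

lemma nonpos_of_forall_mul_le_mul_sq {A B : ℝ} (hB : 0 ≤ B)
    (h : ∀ t, 0 < t → t ≤ 1 → t * A ≤ t ^ 2 * B) : A ≤ 0 := by
  by_contra! hA
  have hs : 0 < A + B := by linarith
  have ht : 0 < A / (A + B) / 2 := by positivity
  have ht' : A / (A + B) ≤ 1 := (div_le_one hs).2 (by linarith)
  have h1 := h _ ht (by linarith)
  have h2 : A ≤ A / (A + B) / 2 * B := by
    refine le_of_mul_le_mul_left ?_ ht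
    linarith
  have h3 : A / (A + B) * (A + B) = A := div_mul_cancel₀ _ hs.ne'
  nlinarith [mul_nonneg ht.le hA.le]

lemma l2sq_sub_mulVec_add_single {n p : ℕ} (X : Matrix (Fin n) (Fin p) ℝ) (y : Fin n → ℝ)
    (b : Fin p → ℝ) (j : Fin p) (t s : ℝ) :
    l2sq (y - X.mulVec (b + t • Pi.single j s)) = l2sq (y - X.mulVec b)
      - 2 * (t * (X.transpose.mulVec (y - X.mulVec b) j * s))
      + t ^ 2 * l2sq (X.mulVec (Pi.single j s)) := by
  rw [l2sq_sub_mulVec_add, Matrix.mulVec_smul, l2sq_smul]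
  have : ∑ k, X.transpose.mulVec (y - X.mulVec b) k * (t • (Pi.single j s : Fin p → ℝ)) k
      = t * (X.transpose.mulVec (y - X.mulVec b) j * s) := by
    rw [Finset.sum_eq_single j]
    · simp only [Pi.smul_apply, Pi.single_eq_same, smul_eq_mul]
      ring
    · intro k _ hk
      simp [hk]
    · simp
  rw [this]

lemma l1_add_le {m : ℕ} (v w : Fin m → ℝ) : l1 (v + w) ≤ l1 v + l1 w := by
  simp only [l1, ← Finset.sum_add_distrib]
  exact Finset.sum_le_sum fun i _ => abs_add_le (v i) (w i)

lemma l1_smul_single {m : ℕ} (j : Fin m) (t s : ℝ) :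
    l1 (t • (Pi.single j s : Fin m → ℝ)) = |t| * |s| := by
  rw [l1, Finset.sum_eq_single j]
  · simp [abs_mul]
  · intro k _ hk
    simp [hk]
  · simp

lemma IsLassoSol.mul_le {n p : ℕ} (hn : 0 < n) {X : Matrix (Fin n) (Fin p) ℝ}
    {y : Fin n → ℝ} {lam : ℝ} (hlam : 0 < lam) {b : Fin p → ℝ} (hb : IsLassoSol X y lam b)
    (j : Fin p) {s : ℝ} (hs : |s| = 1) :
    X.transpose.mulVec (y - X.mulVec b) j * s ≤ lam * n := by
  have hn' : (0 : ℝ) < n := by exact_mod_cast hn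
  rw [← sub_nonpos]
  refine nonpos_of_forall_mul_le_mul_sq
    (B := l2sq (X.mulVec (Pi.single j s)) / 2)
    (by linarith [l2sq_nonneg (X.mulVec (Pi.single j s))])
    fun t ht _ => ?_
  have h := hb (b + t • Pi.single j s)
  have hl : l1 (b + t • Pi.single j s) ≤ l1 b + t := by
    have := l1_add_le b (t • Pi.single j s)
    rwa [l1_smul_single, hs, abs_of_pos ht, mul_one] at this
  have hl' := mul_le_mul_of_nonneg_left hl hlam.le
  rw [lassoObj, lassoObj, l2sq_sub_mulVec_add_single] at h
  have h' : l2sq (y - X.mulVec b) / (2 * (n : ℝ)) ≤ (l2sq (y - X.mulVec b)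
      - 2 * (t * (X.transpose.mulVec (y - X.mulVec b) j * s))
      + t ^ 2 * l2sq (X.mulVec (Pi.single j s))) / (2 * (n : ℝ)) + lam * t := by linarith
  rw [← sub_le_iff_le_add, ← mul_le_mul_iff_left₀ (show (0 : ℝ) < 2 * n by positivity), sub_mul,
    div_mul_cancel₀ _ (by positivity), div_mul_cancel₀ _ (by positivity)] at h'
  linarith

lemma IsLassoSol.abs_lassoSubgrad_le_one {n p : ℕ} (hn : 0 < n)
    {X : Matrix (Fin n) (Fin p) ℝ} {y : Fin n → ℝ} {lam : ℝ} (hlam : 0 < lam)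
    {b : Fin p → ℝ} (hb : IsLassoSol X y lam b) (j : Fin p) :
    |lassoSubgrad X y lam b j| ≤ 1 := by
  have hpos : 0 < lam * (n : ℝ) := mul_pos hlam (by exact_mod_cast hn)
  have h1 := hb.mul_le hn hlam j (s := 1) (by simp)
  have h2 := hb.mul_le hn hlam j (s := -1) (by simp)
  rw [lassoSubgrad, abs_div, abs_of_pos hpos, div_le_one hpos, abs_le]
  constructor <;> linarith

/-- Coordinatewise first-order optimality condition for the Sign-Least-Squares Lasso. -/
lemma IsSLSSol.gradient_mul_sub_nonpos {n p : ℕ} {X : Matrix (Fin n) (Fin p) ℝ}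
    {y : Fin n → ℝ} {lam : ℝ} {bhat bbar : Fin p → ℝ} (h : IsSLSSol X y lam bhat bbar)
    {j : Fin p} (hj : |lassoSubgrad X y lam bhat j| = 1) {c : ℝ}
    (hc : 0 ≤ lassoSubgrad X y lam bhat j * c) :
    X.transpose.mulVec (y - X.mulVec bbar) j * (c - bbar j) ≤ 0 := by
  obtain ⟨hsupp, hsign, hmin⟩ := h
  refine nonpos_of_forall_mul_le_mul_sq
    (B := l2sq (X.mulVec (Pi.single j (c - bbar j))) / 2)
    (by linarith [l2sq_nonneg (X.mulVec (Pi.single j (c - bbar j)))]) fun t ht ht1 => ?_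
  have hle := hmin (bbar + t • Pi.single j (c - bbar j)) ⟨fun k hk => ?_, fun k => ?_⟩
  · rw [l2sq_sub_mulVec_add_single] at hle
    linarith
  · have hkj : k ≠ j := by
      rintro rfl
      exact hk hj
    simp [hkj, hsupp k hk]
  · by_cases hkj : k = j
    · subst hkj
      simp only [Pi.add_apply, Pi.smul_apply, Pi.single_eq_same, smul_eq_mul]
      nlinarith [mul_nonneg ht.le hc, mul_nonneg (sub_nonneg.2 ht1) (hsign k)]
    · simpa [hkj] using hsign k

lemma mul_le_mul_abs_sub_of_abs_lt_one {g ρ lam : ℝ} (hρ : |ρ| < 1)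
    (hlam : |g| / (1 - |ρ|) ≤ lam) (c : ℝ) : g * c ≤ lam * (|c| - ρ * c) := by
  have hpos : 0 < 1 - |ρ| := by linarith
  have hlam0 : 0 ≤ lam := le_trans (by positivity) hlam
  rw [div_le_iff₀ hpos] at hlam
  have h1 : g * c ≤ |g| * |c| := (le_abs_self _).trans (abs_mul g c).le
  have h2 : ρ * c ≤ |ρ| * |c| := (le_abs_self _).trans (abs_mul ρ c).le
  nlinarith [mul_le_mul_of_nonneg_right hlam (abs_nonneg c), mul_le_mul_of_nonneg_left h2 hlam0]

lemma mul_sub_le_mul_abs_sub_of_abs_eq_one {g ρ lam b : ℝ} (hρ : |ρ| = 1)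
    (hlam : |g| ≤ lam) (hg : ∀ c, 0 ≤ ρ * c → g * (c - b) ≤ 0) (c : ℝ) :
    g * (c - b) ≤ lam * (|c| - ρ * c) := by
  have hlam0 : 0 ≤ lam := (abs_nonneg g).trans hlam
  have hle : ρ * c ≤ |c| := by
    simpa [abs_mul, hρ] using le_abs_self (ρ * c)
  rcases le_or_gt 0 (ρ * c) with hc | hc
  · exact (hg c hc).trans (mul_nonneg hlam0 (sub_nonneg.2 hle))
  · have h0 := hg 0 (by simp)
    have h1 : g * c ≤ |g| * |c| := (le_abs_self _).trans (abs_mul g c).le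
    nlinarith [mul_le_mul_of_nonneg_right hlam (abs_nonneg c), mul_nonneg hlam0 (neg_nonneg.2 hc.le)]

theorem stmt18 (n p : ℕ) (hn : 0 < n) (hp : 0 < p)
    (X : Matrix (Fin n) (Fin p) ℝ) (y : Fin n → ℝ)
    (lam1 : ℝ) (hlam1 : 0 < lam1)
    (bhat : Fin p → ℝ) (hb : IsLassoSol X y lam1 bhat)
    (bbar : Fin p → ℝ) (hsls : IsSLSSol X y lam1 bhat bbar) :
    ∃ lam0 > 0, ∀ lam2 : ℝ, lam0 ≤ lam2 → IsBregmanSol X y lam1 lam2 bhat bbar := by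
  have hn' : (0 : ℝ) < n := by exact_mod_cast hn
  set ρ := lassoSubgrad X y lam1 bhat with hρ
  set g : Fin p → ℝ := fun j => X.transpose.mulVec (y - X.mulVec bbar) j / n with hg
  have hρ1 : ∀ j, |ρ j| ≤ 1 := hb.abs_lassoSubgrad_le_one hn hlam1
  set w : Fin p → ℝ := fun j => |g j| + |g j| / (1 - |ρ j|)
  have hq : ∀ j, 0 ≤ |g j| / (1 - |ρ j|) := fun j =>
    div_nonneg (abs_nonneg _) (sub_nonneg.2 (hρ1 j))
  have hw0 : ∀ j, 0 ≤ w j := fun j => add_nonneg (abs_nonneg _) (hq j)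
  refine ⟨1 + ∑ j, w j, by linarith [Finset.sum_nonneg fun j (_ : j ∈ Finset.univ) => hw0 j],
    fun lam2 hlam2 β => ?_⟩
  have hwl : ∀ j, |g j| + |g j| / (1 - |ρ j|) ≤ lam2 := fun j => by
    have := Finset.single_le_sum (fun j _ => hw0 j) (Finset.mem_univ j)
    exact this.trans (by linarith)
  have hcoord : ∀ j, g j * (β j - bbar j) ≤ lam2 * (|β j| - ρ j * β j) := fun j => by
    by_cases hj : |ρ j| = 1
    · refine mul_sub_le_mul_abs_sub_of_abs_eq_one hj (by linarith [hwl j, hq j])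
        (fun c hc => ?_) _
      rw [hg, div_mul_eq_mul_div]
      exact div_nonpos_of_nonpos_of_nonneg (hsls.gradient_mul_sub_nonpos hj hc) hn'.le
    · rw [hsls.1 j hj, sub_zero]
      exact mul_le_mul_abs_sub_of_abs_lt_one (lt_of_le_of_ne (hρ1 j) hj)
        (by linarith [hwl j, abs_nonneg (g j)]) _
  have hbar : ∀ j, |bbar j| = ρ j * bbar j := fun j => by
    by_cases hj : |ρ j| = 1
    · rw [← abs_of_nonneg (hsls.2.1 j), abs_mul, hj, one_mul]
    · simp [hsls.1 j hj]
  have hexp := l2sq_sub_mulVec_add X y bbar (β - bbar)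
  rw [add_sub_cancel] at hexp
  have hsum : ∑ j, X.transpose.mulVec (y - X.mulVec bbar) j * (β - bbar) j
      = n * ∑ j, g j * (β j - bbar j) := by
    rw [Finset.mul_sum]
    refine Finset.sum_congr rfl fun j _ => ?_
    simp only [hg, Pi.sub_apply]
    field_simp
  have hquad : l2sq (y - X.mulVec bbar) / (2 * (n : ℝ)) - ∑ j, g j * (β j - bbar j)
      ≤ l2sq (y - X.mulVec β) / (2 * (n : ℝ)) := by
    rw [le_div_iff₀ (by positivity), sub_mul, div_mul_cancel₀ _ (by positivity), hexp, hsum]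
    linarith [l2sq_nonneg (X.mulVec (β - bbar))]
  have htot := Finset.sum_le_sum fun j (_ : j ∈ Finset.univ) => hcoord j
  rw [← Finset.mul_sum, Finset.sum_sub_distrib] at htot
  have hzero : l1 bbar - ∑ j, ρ j * bbar j = 0 :=
    sub_eq_zero.2 (Finset.sum_congr rfl fun j _ => hbar j)
  rw [bregmanObj, bregmanObj, ← hρ, hzero, mul_zero, add_zero]
  change _ ≤ _ + lam2 * (∑ j, |β j| - ∑ j, ρ j * β j)
  linarith
end

section
/- Consider the model y = Xβ* + ε with ε ~ N(0, σ²I_n), where β* has support of cardinality s and columns of X satisfy ‖X_j‖₂² = n. Suppose X satisfies RE(3, s) and λ = 5σ√(2 log(p/δ)/n) for δ ∈ (0,1). Let β̂ = β̂^{λ} be a Lasso solution with tuning parameter λ and let β̄ be the Sign-Least-Squares Lasso associated with β̂. Then with probability at least 1 − δ, (1/n)‖X(β* − β̄)‖₂² + (1/n)‖X(β* − β̂)‖₂² ≤ λ²s/κ²(1, s) + 9λ²s/(4κ²(3, s)). -/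
open MeasureTheory ProbabilityTheory Finset

lemma gaussianVec_map_dotProduct {n : ℕ} (σ : ℝ) (a : Fin n → ℝ) :
    (gaussianVec n σ).map (fun ε => ∑ i, a i * ε i) =
      gaussianReal 0 (σ ^ 2 * ∑ i, a i ^ 2).toNNReal := by
  have hlaw : HasGaussianLaw (fun ε : Fin n → ℝ => ∑ i, a i * ε i) (gaussianVec n σ) := by
    refine iIndepFun.hasGaussianLaw_fun_sum (X := fun i (ε : Fin n → ℝ) => a i * ε i) ?_ ?_
    · intro i
      constructor
      have hmap : (gaussianVec n σ).map (fun ε => a i * ε i) =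
          (gaussianReal 0 (σ ^ 2).toNNReal).map (fun x => a i * x) := by
        rw [← (measurePreserving_eval (fun _ : Fin n => gaussianReal 0 (σ ^ 2).toNNReal) i).map_eq,
          Measure.map_map (by fun_prop) (by fun_prop)]
        rfl
      rw [hmap, gaussianReal_map_const_mul]
      infer_instance
    · exact iIndepFun_pi (X := fun i (x : ℝ) => a i * x) (by fun_prop)
  rw [hlaw.map_eq_gaussianReal]
  congr 2
  · unfold gaussianVec
    rw [integral_finsetSum]
    · simp [integral_const_mul, integral_eval]
    · exact fun i _ => (integrable_eval IsGaussian.integrable_id).const_mul _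
  · have hsum : (fun ε : Fin n → ℝ => ∑ i, a i * ε i) = ∑ i, fun ε : Fin n → ℝ => a i * ε i := by
      ext; simp
    unfold gaussianVec
    rw [hsum, variance_sum_pi (X := fun i (x : ℝ) => a i * x)
      (fun i => IsGaussian.memLp_two_id.const_mul _)]
    change ∑ i, Var[fun x => a i * id x; gaussianReal 0 (σ ^ 2).toNNReal] = _
    simp_rw [variance_const_mul, variance_id_gaussianReal, Real.coe_toNNReal _ (sq_nonneg σ)]
    rw [← Finset.sum_mul, mul_comm]

lemma gaussianReal_Ioi_le {v : NNReal} (hv : v ≠ 0) {t : ℝ} (ht : 0 ≤ t) :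
    gaussianReal 0 v (Set.Ioi t) ≤
      ENNReal.ofReal (Real.exp (-t ^ 2 / (2 * v))) * gaussianReal 0 v (Set.Ioi 0) := by
  have hshift : gaussianReal 0 v (Set.Ioi t) = gaussianReal (0 - t) v (Set.Ioi 0) := by
    rw [← gaussianReal_map_sub_const, Measure.map_apply (by fun_prop) measurableSet_Ioi]
    congr 1
    ext x
    simp
  rw [hshift, gaussianReal_apply _ hv, gaussianReal_apply _ hv, ← lintegral_const_mul _
    (measurable_gaussianPDF _ _)]
  refine setLIntegral_mono' measurableSet_Ioi fun x hx => ?_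
  rw [gaussianPDF, gaussianPDF, ← ENNReal.ofReal_mul (Real.exp_pos _).le]
  apply ENNReal.ofReal_le_ofReal
  rw [gaussianPDFReal, gaussianPDFReal, mul_left_comm, ← Real.exp_add, ← add_div]
  gcongr
  nlinarith [mul_nonneg ht (le_of_lt (Set.mem_Ioi.mp hx))]

lemma gaussianReal_zero_Iio_neg (v : NNReal) (t : ℝ) :
    gaussianReal 0 v (Set.Iio (-t)) = gaussianReal 0 v (Set.Ioi t) := by
  nth_rewrite 2 [← neg_zero]
  rw [← gaussianReal_map_neg, Measure.map_apply (by fun_prop) measurableSet_Ioi]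
  congr 1
  ext x
  simp

/-- The two-sided Gaussian tail bound, without a prefactor `2`. -/
lemma gaussianReal_lt_abs_le {v : NNReal} (hv : v ≠ 0) {t : ℝ} (ht : 0 ≤ t) :
    gaussianReal 0 v {x | t < |x|} ≤ ENNReal.ofReal (Real.exp (-t ^ 2 / (2 * v))) := by
  have hset : {x : ℝ | t < |x|} = Set.Iio (-t) ∪ Set.Ioi t := by
    ext x
    simp [lt_abs, or_comm, lt_neg]
  have hhalf : gaussianReal 0 v (Set.Ioi 0) + gaussianReal 0 v (Set.Ioi 0) ≤ 1 := by
    nth_rewrite 1 [← gaussianReal_zero_Iio_neg]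
    rw [neg_zero, ← measure_union _ measurableSet_Ioi]
    · exact prob_le_one
    · exact Set.disjoint_left.mpr fun x h1 h2 =>
        lt_asymm (Set.mem_Iio.mp h1) (Set.mem_Ioi.mp h2)
  calc gaussianReal 0 v {x | t < |x|}
      ≤ gaussianReal 0 v (Set.Iio (-t)) + gaussianReal 0 v (Set.Ioi t) :=
        hset ▸ measure_union_le _ _
    _ ≤ ENNReal.ofReal (Real.exp (-t ^ 2 / (2 * v))) *
          (gaussianReal 0 v (Set.Ioi 0) + gaussianReal 0 v (Set.Ioi 0)) := by
        rw [gaussianReal_zero_Iio_neg, mul_add]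
        gcongr <;> exact gaussianReal_Ioi_le hv ht
    _ ≤ _ := mul_le_of_le_one_right' hhalf

lemma ofReal_one_sub_le_gaussianVec {n p : ℕ} (hn : 0 < n) (hp : 0 < p) {σ : ℝ} (hσ : 0 < σ)
    (X : Matrix (Fin n) (Fin p) ℝ) (hX : ∀ j, ∑ i, (X i j) ^ 2 = (n : ℝ))
    {δ : ℝ} (hδ : δ ∈ Set.Ioo (0 : ℝ) 1) :
    ENNReal.ofReal (1 - δ) ≤ gaussianVec n σ {ε | ∀ j, |∑ i, X i j * ε i| ≤
      n * (σ * Real.sqrt (2 * Real.log ((p : ℝ) / δ) / (n : ℝ)))} := by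
  have : IsProbabilityMeasure (gaussianVec n σ) := by unfold gaussianVec; infer_instance
  obtain ⟨hδ0, hδ1⟩ := hδ
  have hn' : (0 : ℝ) < n := by exact_mod_cast hn
  have hp' : (1 : ℝ) ≤ p := by exact_mod_cast hp
  set L := Real.log ((p : ℝ) / δ) with hL
  have hL0 : 0 ≤ L := Real.log_nonneg ((one_le_div hδ0).mpr (by linarith))
  set t := (n : ℝ) * (σ * Real.sqrt (2 * L / (n : ℝ))) with ht
  have ht0 : 0 ≤ t := by positivity
  set G : Set (Fin n → ℝ) := {ε | ∀ j, |∑ i, X i j * ε i| ≤ t} with hG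
  have hGm : MeasurableSet G := by
    rw [hG, Set.ofPred_forall]
    exact MeasurableSet.iInter fun j => measurableSet_le (by fun_prop) (by fun_prop)
  have hv : (σ ^ 2 * (n : ℝ)).toNNReal ≠ 0 := by
    simp only [ne_eq, Real.toNNReal_eq_zero, not_le]; positivity
  have hcol : ∀ j, gaussianVec n σ {ε | t < |∑ i, X i j * ε i|} ≤ ENNReal.ofReal (δ / p) := by
    intro j
    have hmap := gaussianVec_map_dotProduct σ (fun i => X i j)
    rw [hX j] at hmap
    have hpre : {ε : Fin n → ℝ | t < |∑ i, X i j * ε i|} =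
      (fun ε : Fin n → ℝ => ∑ i, X i j * ε i) ⁻¹' {x | t < |x|} := rfl
    rw [hpre, ← Measure.map_apply (by fun_prop) (measurableSet_lt (by fun_prop) (by fun_prop)), hmap]
    refine (gaussianReal_lt_abs_le hv ht0).trans (ENNReal.ofReal_le_ofReal (le_of_eq ?_))
    have hexp : -t ^ 2 / (2 * ((σ ^ 2 * (n : ℝ)).toNNReal : ℝ)) = -L := by
      rw [Real.coe_toNNReal _ (by positivity), ht, mul_pow, mul_pow, Real.sq_sqrt (by positivity)]
      field_simp
    rw [hexp, hL, Real.exp_neg, Real.exp_log (by positivity), inv_div]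
  have hbad : gaussianVec n σ Gᶜ ≤ ENNReal.ofReal δ := by
    have hsub : Gᶜ ⊆ ⋃ j, {ε | t < |∑ i, X i j * ε i|} := by
      intro ε hε
      simpa [hG] using hε
    calc gaussianVec n σ Gᶜ ≤ ∑ j, gaussianVec n σ {ε | t < |∑ i, X i j * ε i|} :=
          (measure_mono hsub).trans (measure_iUnion_fintype_le _ _)
      _ ≤ ∑ _j : Fin p, ENNReal.ofReal (δ / p) := Finset.sum_le_sum fun j _ => hcol j
      _ = ENNReal.ofReal δ := by
          rw [Finset.sum_const, Finset.card_univ, Fintype.card_fin, nsmul_eq_mul,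
            ← ENNReal.ofReal_natCast, ← ENNReal.ofReal_mul (by positivity)]
          congr 1
          field_simp
  have hGc : gaussianVec n σ G = 1 - gaussianVec n σ Gᶜ := by
    rw [← prob_compl_eq_one_sub hGm.compl, compl_compl]
  rw [hGc, ENNReal.ofReal_sub _ hδ0.le, ENNReal.ofReal_one]
  exact tsub_le_tsub_left hbad 1

lemma l2sq_eq_dotProduct {m : ℕ} (v : Fin m → ℝ) : l2sq v = v ⬝ᵥ v := by
  simp [l2sq, dotProduct, sq]

lemma l2sq_sub_smul {m : ℕ} (u w : Fin m → ℝ) (t : ℝ) :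
    l2sq (u - t • w) = l2sq u - 2 * t * (u ⬝ᵥ w) + t ^ 2 * l2sq w := by
  simp only [l2sq_eq_dotProduct, sub_dotProduct, dotProduct_sub, smul_dotProduct,
    dotProduct_smul, smul_eq_mul, dotProduct_comm w u]
  ring

lemma residual_add_smul {n p : ℕ} (X : Matrix (Fin n) (Fin p) ℝ) (y : Fin n → ℝ)
    (b d : Fin p → ℝ) (t : ℝ) :
    y - X.mulVec (b + t • d) = (y - X.mulVec b) - t • X.mulVec d := by
  rw [Matrix.mulVec_add, Matrix.mulVec_smul, sub_sub]

lemma nonneg_of_forall_mul_add_sq_mul_nonneg {a b : ℝ}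
    (h : ∀ t : ℝ, 0 < t → t ≤ 1 → 0 ≤ t * a + t ^ 2 * b) : 0 ≤ a := by
  by_contra! ha
  have hb : 0 < |b| + 1 := by positivity
  set t := min 1 (-a / (2 * (|b| + 1))) with ht
  have ht0 : 0 < t := lt_min one_pos (div_pos (by linarith) (by linarith))
  have ht2 : t * (2 * (|b| + 1)) ≤ -a := (le_div_iff₀ (by linarith)).mp (min_le_right _ _)
  have h1 : 0 ≤ t * (a + t * b) := by
    have := h t ht0 (min_le_left _ _)
    linarith [show t * (a + t * b) = t * a + t ^ 2 * b by ring]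
  have h2 : 0 ≤ a + t * b := nonneg_of_mul_nonneg_right h1 ht0
  nlinarith [mul_le_mul_of_nonneg_left (le_abs_self b) ht0.le]

lemma l1_add_smul_sub_le {p : ℕ} (b β : Fin p → ℝ) {t : ℝ} (ht0 : 0 ≤ t) (ht1 : t ≤ 1) :
    l1 (b + t • (β - b)) ≤ l1 b + t * (l1 β - l1 b) := by
  unfold l1
  rw [← Finset.sum_sub_distrib, Finset.mul_sum, ← Finset.sum_add_distrib]
  refine Finset.sum_le_sum fun j _ => ?_
  have hconv : (b + t • (β - b)) j = (1 - t) * b j + t * β j := by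
    simp only [Pi.add_apply, Pi.smul_apply, Pi.sub_apply, smul_eq_mul]
    ring
  rw [hconv]
  refine (abs_add_le _ _).trans (le_of_eq ?_)
  rw [abs_mul, abs_mul, abs_of_nonneg ht0, abs_of_nonneg (sub_nonneg.mpr ht1)]
  ring

lemma IsLassoSol.dotProduct_le {n p : ℕ} (hn : 0 < n) {X : Matrix (Fin n) (Fin p) ℝ}
    {y : Fin n → ℝ} {lam : ℝ} (hlam : 0 ≤ lam) {b : Fin p → ℝ} (hb : IsLassoSol X y lam b)
    (β : Fin p → ℝ) :
    (y - X.mulVec b) ⬝ᵥ X.mulVec (β - b) ≤ n * lam * (l1 β - l1 b) := by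
  have hn' : (0 : ℝ) < n := by exact_mod_cast hn
  rw [← sub_nonneg]
  refine nonneg_of_forall_mul_add_sq_mul_nonneg (b := l2sq (X.mulVec (β - b)) / 2) ?_
  intro t ht0 ht1
  have hmin := hb (b + t • (β - b))
  unfold lassoObj at hmin
  rw [residual_add_smul, l2sq_sub_smul] at hmin
  have hl1 := mul_le_mul_of_nonneg_left (l1_add_smul_sub_le b β ht0.le ht1) hlam
  have hobj := hmin.trans (add_le_add_right hl1 _)
  field_simp at hobj
  linarith

lemma dotProduct_mulVec_eq_sum {n p : ℕ} (X : Matrix (Fin n) (Fin p) ℝ) (r : Fin n → ℝ)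
    (d : Fin p → ℝ) : r ⬝ᵥ X.mulVec d = ∑ j, X.transpose.mulVec r j * d j := by
  rw [Matrix.dotProduct_mulVec, Matrix.mulVec_transpose]
  rfl

lemma IsLassoSol.correlation {n p : ℕ} (hn : 0 < n) {X : Matrix (Fin n) (Fin p) ℝ}
    {y : Fin n → ℝ} {lam : ℝ} (hlam : 0 ≤ lam) {b : Fin p → ℝ} (hb : IsLassoSol X y lam b)
    (j : Fin p) :
    |X.transpose.mulVec (y - X.mulVec b) j| ≤ n * lam ∧
      X.transpose.mulVec (y - X.mulVec b) j * b j = n * lam * |b j| := by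
  set g := X.transpose.mulVec (y - X.mulVec b) j with hg
  have hcoord : ∀ x : ℝ, g * (x - b j) ≤ n * lam * (|x| - |b j|) := by
    intro x
    have h := hb.dotProduct_le hn hlam (Function.update b j x)
    rw [dotProduct_mulVec_eq_sum, l1, l1, ← Finset.sum_sub_distrib,
      Finset.sum_eq_single j, Finset.sum_eq_single j] at h
    · simpa using h
    all_goals simp +contextual
  have hnl : 0 ≤ n * lam := by positivity
  have hup := hcoord (b j + 1)
  have hdown := hcoord (b j - 1)
  have hzero := hcoord 0
  have h1 := mul_le_mul_of_nonneg_left (abs_add_le (b j) 1) hnl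
  have h2 := mul_le_mul_of_nonneg_left (abs_sub (b j) 1) hnl
  rw [abs_one] at h1 h2
  rw [abs_zero] at hzero
  have hbound : |g| ≤ n * lam := abs_le.mpr ⟨by linarith, by linarith⟩
  refine ⟨hbound, le_antisymm ?_ (by linarith)⟩
  calc g * b j ≤ |g| * |b j| := by rw [← abs_mul]; exact le_abs_self _
    _ ≤ n * lam * |b j| := by gcongr

lemma sum_mul_sub_ge {p : ℕ} {c : ℝ} {g b bstar : Fin p → ℝ} (hg : ∀ j, |g j| ≤ c)
    (hgb : ∀ j, g j * b j = c * |b j|) {S : Finset (Fin p)} (hS : ∀ j ∉ S, bstar j = 0) :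
    c * (∑ j ∈ Sᶜ, |(b - bstar) j| - ∑ j ∈ S, |(b - bstar) j|) ≤ ∑ j, g j * (b - bstar) j := by
  rw [← Finset.sum_add_sum_compl S, mul_sub, Finset.mul_sum, Finset.mul_sum, sub_eq_neg_add,
    ← Finset.sum_neg_distrib]
  refine add_le_add (Finset.sum_le_sum fun j _ => ?_) (Finset.sum_le_sum fun j hj => ?_)
  · have h := mul_le_mul_of_nonneg_right (hg j) (abs_nonneg ((b - bstar) j))
    rw [← abs_mul] at h
    linarith [neg_abs_le (g j * (b - bstar) j)]
  · simp [hS j (by simpa using hj), hgb]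

lemma RE.cone_gap_le {n p s : ℕ} (hn : 0 < n) {X : Matrix (Fin n) (Fin p) ℝ} {c κ : ℝ}
    (hc : 0 ≤ c) (hRE : RE X c s κ) {S : Finset (Fin p)} (hS : S.card ≤ s) (Δ : Fin p → ℝ) :
    c * ∑ j ∈ S, |Δ j| - ∑ j ∈ Sᶜ, |Δ j| ≤
      c * (Real.sqrt s / κ) * Real.sqrt (l2sq (X.mulVec Δ) / n) := by
  have hn' : (0 : ℝ) < n := by exact_mod_cast hn
  obtain ⟨hκ, hRE⟩ := hRE
  rcases le_total (∑ j ∈ Sᶜ, |Δ j|) (c * ∑ j ∈ S, |Δ j|) with h | h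
  · have hre := hRE S hS Δ h
    have hcs : (∑ j ∈ S, |Δ j|) ^ 2 ≤ s * ∑ j ∈ S, Δ j ^ 2 := by
      have h1 := sq_sum_le_card_mul_sum_sq (s := S) (f := fun j => |Δ j|)
      simp only [sq_abs] at h1
      refine h1.trans ?_
      gcongr
    have hl1 : ∑ j ∈ S, |Δ j| ≤ Real.sqrt s / κ * Real.sqrt (l2sq (X.mulVec Δ) / n) := by
      refine (pow_le_pow_iff_left₀ (Finset.sum_nonneg fun _ _ => abs_nonneg _) (by positivity)
        two_ne_zero).mp ?_
      rw [mul_pow, div_pow, Real.sq_sqrt (by positivity),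
        Real.sq_sqrt (div_nonneg (l2sq_nonneg _) hn'.le)]
      refine hcs.trans ?_
      rw [div_mul_div_comm, le_div_iff₀ (by positivity)]
      calc (s : ℝ) * (∑ j ∈ S, Δ j ^ 2) * (κ ^ 2 * n)
          = s * (κ ^ 2 * (n * ∑ j ∈ S, Δ j ^ 2)) := by ring
        _ ≤ s * l2sq (X.mulVec Δ) := by gcongr
    have hcompl : 0 ≤ ∑ j ∈ Sᶜ, |Δ j| := Finset.sum_nonneg fun _ _ => abs_nonneg _
    nlinarith [mul_le_mul_of_nonneg_left hl1 hc]
  · have : 0 ≤ c * (Real.sqrt s / κ) * Real.sqrt (l2sq (X.mulVec Δ) / n) := by positivity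
    linarith

lemma dotProduct_mulVec_le_of_abs_le {n p : ℕ} {X : Matrix (Fin n) (Fin p) ℝ} {ε : Fin n → ℝ}
    {c : ℝ} (h : ∀ j, |X.transpose.mulVec ε j| ≤ c) (S : Finset (Fin p)) (d : Fin p → ℝ) :
    ε ⬝ᵥ X.mulVec d ≤ c * (∑ j ∈ S, |d j| + ∑ j ∈ Sᶜ, |d j|) := by
  rw [dotProduct_mulVec_eq_sum, Finset.sum_add_sum_compl, Finset.mul_sum]
  refine Finset.sum_le_sum fun j _ => (le_abs_self _).trans ?_
  rw [abs_mul]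
  gcongr
  exact h j

section SignLeastSquares

variable {n p : ℕ} {X : Matrix (Fin n) (Fin p) ℝ} {y : Fin n → ℝ} {lam : ℝ}
  {bhat bbar : Fin p → ℝ}

lemma IsSLSSol.correlation (hn : 0 < n) (hlam : 0 < lam)
    (hbar : IsSLSSol X y lam bhat bbar) (j : Fin p) :
    X.transpose.mulVec (y - X.mulVec bhat) j * bbar j = n * lam * |bbar j| := by
  have hnl : (0 : ℝ) < lam * n := mul_pos hlam (by exact_mod_cast hn)
  have hρ : X.transpose.mulVec (y - X.mulVec bhat) j = lassoSubgrad X y lam bhat j * (lam * n) :=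
    (div_mul_cancel₀ _ hnl.ne').symm
  have habs : lassoSubgrad X y lam bhat j * bbar j = |bbar j| := by
    by_cases h : |lassoSubgrad X y lam bhat j| = 1
    · rw [← abs_of_nonneg (hbar.2.1 j), abs_mul, h, one_mul]
    · simp [hbar.1 j h]
  rw [hρ, ← habs]
  ring

lemma IsLassoSol.sls_feasible (hn : 0 < n) (hlam : 0 < lam) (hb : IsLassoSol X y lam bhat) :
    (∀ j, |lassoSubgrad X y lam bhat j| ≠ 1 → bhat j = 0) ∧
      ∀ j, 0 ≤ lassoSubgrad X y lam bhat j * bhat j := by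
  have hnl : (0 : ℝ) < lam * n := mul_pos hlam (by exact_mod_cast hn)
  have habs : ∀ j, lassoSubgrad X y lam bhat j * bhat j = |bhat j| := by
    intro j
    rw [lassoSubgrad, div_mul_eq_mul_div, (hb.correlation hn hlam.le j).2, mul_comm (n : ℝ),
      mul_div_cancel_left₀ _ hnl.ne']
  refine ⟨fun j h => ?_, fun j => habs j ▸ abs_nonneg _⟩
  by_contra hne
  apply h
  have h2 := congrArg abs (habs j)
  rw [abs_mul, abs_abs] at h2
  exact mul_right_cancel₀ (abs_ne_zero.mpr hne) (h2.trans (one_mul _).symm)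

lemma IsSLSSol.dotProduct_nonpos (hbar : IsSLSSol X y lam bhat bbar) {β : Fin p → ℝ}
    (hβ : (∀ j, |lassoSubgrad X y lam bhat j| ≠ 1 → β j = 0) ∧
      ∀ j, 0 ≤ lassoSubgrad X y lam bhat j * β j) :
    (y - X.mulVec bbar) ⬝ᵥ X.mulVec (β - bbar) ≤ 0 := by
  rw [← neg_nonneg]
  refine nonneg_of_forall_mul_add_sq_mul_nonneg (b := l2sq (X.mulVec (β - bbar)) / 2) ?_
  intro t ht0 ht1
  have hmin := hbar.2.2 (bbar + t • (β - bbar)) ⟨fun j hj => ?_, fun j => ?_⟩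
  · rw [residual_add_smul, l2sq_sub_smul] at hmin
    linarith
  · simp [hbar.1 j hj, hβ.1 j hj]
  · have h1 := mul_nonneg (sub_nonneg.mpr ht1) (hbar.2.1 j)
    have h2 := mul_nonneg ht0.le (hβ.2 j)
    simp only [Pi.add_apply, Pi.smul_apply, Pi.sub_apply, smul_eq_mul]
    linarith

end SignLeastSquares

/-- The deterministic oracle inequality, on the event `‖Xᵀε‖_∞ ≤ nλ/4`. -/
lemma sls_add_lasso_prediction_le {n p s : ℕ} (hn : 0 < n) {X : Matrix (Fin n) (Fin p) ℝ}
    {bstar : Fin p → ℝ} (hs : (Finset.univ.filter fun j => bstar j ≠ 0).card = s)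
    {κ3 κ1 : ℝ} (hRE3 : RE X 3 s κ3) (hRE1 : RE X 1 s κ1) {lam : ℝ} (hlam : 0 < lam)
    {ε : Fin n → ℝ} (hε : ∀ j, |X.transpose.mulVec ε j| ≤ n * lam / 4) {bhat bbar : Fin p → ℝ}
    (hhat : IsLassoSol X (X.mulVec bstar + ε) lam bhat)
    (hbar : IsSLSSol X (X.mulVec bstar + ε) lam bhat bbar) :
    l2sq (X.mulVec (bstar - bbar)) / (n : ℝ) + l2sq (X.mulVec (bstar - bhat)) / (n : ℝ) ≤
      lam ^ 2 * (s : ℝ) / κ1 ^ 2 + 9 * lam ^ 2 * (s : ℝ) / (4 * κ3 ^ 2) := by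
  have hn' : (0 : ℝ) < n := by exact_mod_cast hn
  set S := Finset.univ.filter fun j => bstar j ≠ 0 with hSdef
  have hS : ∀ j ∉ S, bstar j = 0 := by
    intro j hj
    simpa [hSdef] using hj
  have hres : ∀ b, X.mulVec bstar + ε - X.mulVec b = ε - X.mulVec (b - bstar) := by
    intro b
    rw [Matrix.mulVec_sub]
    abel
  have hneg : ∀ b, l2sq (X.mulVec (bstar - b)) = l2sq (X.mulVec (b - bstar)) := by
    intro b
    rw [← neg_sub, Matrix.mulVec_neg]
    simp [l2sq]
  have hg := fun j => (hhat.correlation hn hlam.le j).1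
  have hkkt_hat := sum_mul_sub_ge hg (fun j => (hhat.correlation hn hlam.le j).2) hS
  have hkkt_bar := sum_mul_sub_ge hg (fun j => hbar.correlation hn hlam j) hS
  rw [← dotProduct_mulVec_eq_sum, hres, sub_dotProduct] at hkkt_hat hkkt_bar
  rw [← l2sq_eq_dotProduct] at hkkt_hat
  have hopt := hbar.dotProduct_nonpos (hhat.sls_feasible hn hlam)
  rw [hres, ← sub_sub_sub_cancel_right bhat bbar bstar,
    Matrix.mulVec_sub X (bhat - bstar), sub_dotProduct, dotProduct_sub, dotProduct_sub, ← l2sq_eq_dotProduct,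
    dotProduct_comm (X.mulVec (bbar - bstar))] at hopt
  have hnoise := dotProduct_mulVec_le_of_abs_le hε S (bbar - bstar)
  have hcone_bar := hRE3.cone_gap_le hn (by norm_num) hs.le (bbar - bstar)
  have hcone_hat := hRE1.cone_gap_le hn (by norm_num) hs.le (bhat - bstar)
  rw [hneg, hneg]
  set A := ∑ j ∈ S, |(bbar - bstar) j|
  set B := ∑ j ∈ Sᶜ, |(bbar - bstar) j|
  set C := ∑ j ∈ S, |(bhat - bstar) j|
  set D := ∑ j ∈ Sᶜ, |(bhat - bstar) j|
  set Q := l2sq (X.mulVec (bbar - bstar))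
  set R := l2sq (X.mulVec (bhat - bstar))
  set u := Real.sqrt (Q / n)
  set v := Real.sqrt (R / n)
  have hu2 : Q / n = u ^ 2 := (Real.sq_sqrt (div_nonneg (l2sq_nonneg _) hn'.le)).symm
  have hv2 : R / n = v ^ 2 := (Real.sq_sqrt (div_nonneg (l2sq_nonneg _) hn'.le)).symm
  have hbasic : u ^ 2 + v ^ 2 ≤ lam / 2 * (3 * A - B) + lam * (1 * C - D) := by
    rw [← hu2, ← hv2, ← add_div, div_le_iff₀ hn']
    linarith
  have hslow : u ^ 2 + v ^ 2 ≤
      (3 / 2 * lam * (Real.sqrt s / κ3)) * u + (lam * (Real.sqrt s / κ1)) * v := by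
    have h1 := mul_le_mul_of_nonneg_left hcone_bar (half_pos hlam).le
    have h2 := mul_le_mul_of_nonneg_left hcone_hat hlam.le
    linarith
  have hrhs : lam ^ 2 * (s : ℝ) / κ1 ^ 2 + 9 * lam ^ 2 * (s : ℝ) / (4 * κ3 ^ 2) =
      (3 / 2 * lam * (Real.sqrt s / κ3)) ^ 2 + (lam * (Real.sqrt s / κ1)) ^ 2 := by
    rw [mul_pow _ (Real.sqrt s / κ3), mul_pow _ (Real.sqrt s / κ1), div_pow, div_pow,
      Real.sq_sqrt (Nat.cast_nonneg s)]
    ring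
  rw [hrhs, hu2, hv2]
  linarith [sq_nonneg (3 / 2 * lam * (Real.sqrt s / κ3) - u),
    sq_nonneg (lam * (Real.sqrt s / κ1) - v)]

theorem stmt19 (n p s : ℕ) (hn : 0 < n) (hp : 0 < p) (σ : ℝ) (hσ : 0 < σ)
    (X : Matrix (Fin n) (Fin p) ℝ)
    (hX : ∀ j, ∑ i, (X i j) ^ 2 = (n : ℝ))
    (bstar : Fin p → ℝ)
    (hs : (Finset.univ.filter fun j => bstar j ≠ 0).card = s)
    (κ3 κ1 : ℝ) (hRE3 : RE X 3 s κ3) (hRE1 : RE X 1 s κ1)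
    (δ : ℝ) (hδ : δ ∈ Set.Ioo (0 : ℝ) 1)
    (lam : ℝ) (hlam : lam = 5 * σ * Real.sqrt (2 * Real.log ((p : ℝ) / δ) / (n : ℝ))) :
    ENNReal.ofReal (1 - δ) ≤
      gaussianVec n σ
        {ε | ∀ bhat bbar : Fin p → ℝ,
          IsLassoSol X (X.mulVec bstar + ε) lam bhat →
          IsSLSSol X (X.mulVec bstar + ε) lam bhat bbar →
          l2sq (X.mulVec (bstar - bbar)) / (n : ℝ) +
              l2sq (X.mulVec (bstar - bhat)) / (n : ℝ) ≤
            lam ^ 2 * (s : ℝ) / κ1 ^ 2 + 9 * lam ^ 2 * (s : ℝ) / (4 * κ3 ^ 2)} := by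
  have hn' : (0 : ℝ) < n := by exact_mod_cast hn
  have hp' : (1 : ℝ) ≤ p := by exact_mod_cast hp
  have hlog : 0 < Real.log ((p : ℝ) / δ) :=
    Real.log_pos ((one_lt_div hδ.1).mpr (hδ.2.trans_le hp'))
  have hlam0 : 0 < lam := by rw [hlam]; positivity
  refine (ofReal_one_sub_le_gaussianVec hn hp hσ X hX hδ).trans (measure_mono ?_)
  intro ε hε bhat bbar hhat hbar
  refine sls_add_lasso_prediction_le hn hs hRE3 hRE1 hlam0 (fun j => ?_) hhat hbar
  have hj : |X.transpose.mulVec ε j| ≤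
      n * (σ * Real.sqrt (2 * Real.log ((p : ℝ) / δ) / (n : ℝ))) := hε j
  have hfifth : σ * Real.sqrt (2 * Real.log ((p : ℝ) / δ) / (n : ℝ)) = lam / 5 := by
    rw [hlam]
    ring
  rw [hfifth] at hj
  linarith [mul_pos hn' hlam0]
end
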